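/- arXiv:2003.06189 — 5 statements merged into one kernel-verified Lean document; each statement's English description precedes it below -/
import Mathlib

section
/- Let a, b > 0 with θ := a/b irrational. Define γ₊ := min( inf_{m∈ℕ, m≥1} (2mπ/a)·tan((π/2)(m/θ − ⌊m/θ⌋)), inf_{m∈ℕ, m≥1} (2mπ/b)·tan((π/2)(mθ − ⌊mθ⌋)) ) and γ₋ := min( inf_{m∈ℕ, m≥1} (−(2mπ/a))·tan((π/2)(m/θ − ⌈m/θ⌉)), inf_{m∈ℕ, m≥1} (−(2mπ/b))·tan((π/2)(mθ − ⌈mθ⌉)) ). If α > 0 and γ₊ < α < π²·μ(θ)/max{a,b}, then the gap set G₊(α) is nonempty and has only finitely many connected components; if α < 0 and γ₋ < −α < π²·μ(θ)/max{a,b}, then the gap set G₋(α) is nonempty and has only finitely many connected components. -/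
open Real

/-- The gap condition set for a rectangular-lattice quantum graph with edge lengths
`a, b` and coupling `α > 0`. -/
def gapSetPlus (a b α : ℝ) : Set ℝ :=
  {k : ℝ | 0 < k ∧ (∀ n : ℤ, k * a / π ≠ n) ∧ (∀ n : ℤ, k * b / π ≠ n) ∧
    2 * k * (Real.tan (k * a / 2 - π / 2 * ⌊k * a / π⌋)
      + Real.tan (k * b / 2 - π / 2 * ⌊k * b / π⌋)) < α}

/-- The gap condition set for a rectangular-lattice quantum graph with edge lengths
`a, b` and coupling `α < 0`. -/
def gapSetMinus (a b α : ℝ) : Set ℝ :=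
  {k : ℝ | 0 < k ∧ (∀ n : ℤ, k * a / π ≠ n) ∧ (∀ n : ℤ, k * b / π ≠ n) ∧
    2 * k * (Real.cot (k * a / 2 - π / 2 * ⌊k * a / π⌋)
      + Real.cot (k * b / 2 - π / 2 * ⌊k * b / π⌋)) < |α|}

/-- The collection of connected components of a set `G ⊆ ℝ`; open spectral gaps
correspond to its elements. -/
def gapComponents (G : Set ℝ) : Set (Set ℝ) :=
  {C : Set ℝ | ∃ k ∈ G, C = connectedComponentIn G k}

/-- The Markov constant `μ(θ)`. -/
noncomputable def markovConstant (θ : ℝ) : ℝ :=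
  sInf {c : ℝ | 0 < c ∧
    {pq : ℕ × ℕ | pq.2 ≠ 0 ∧ |θ - (pq.1 : ℝ) / (pq.2 : ℝ)| < c / (pq.2 : ℝ) ^ 2}.Infinite}

/-- The threshold `γ₊` for the rectangular lattice with ratio `θ = a/b`. -/
noncomputable def gammaPlus (a b θ : ℝ) : ℝ :=
  min
    (sInf {x : ℝ | ∃ m : ℕ, 1 ≤ m ∧
      x = 2 * m * π / a * Real.tan (π / 2 * ((m : ℝ) / θ - ⌊(m : ℝ) / θ⌋))})
    (sInf {x : ℝ | ∃ m : ℕ, 1 ≤ m ∧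
      x = 2 * m * π / b * Real.tan (π / 2 * ((m : ℝ) * θ - ⌊(m : ℝ) * θ⌋))})

/-- The threshold `γ₋` for the rectangular lattice with ratio `θ = a/b`. -/
noncomputable def gammaMinus (a b θ : ℝ) : ℝ :=
  min
    (sInf {x : ℝ | ∃ m : ℕ, 1 ≤ m ∧
      x = -(2 * m * π / a) * Real.tan (π / 2 * ((m : ℝ) / θ - ⌈(m : ℝ) / θ⌉))})
    (sInf {x : ℝ | ∃ m : ℕ, 1 ≤ m ∧
      x = -(2 * m * π / b) * Real.tan (π / 2 * ((m : ℝ) * θ - ⌈(m : ℝ) * θ⌉))})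

lemma half_angle_eq (k a : ℝ) (n : ℤ) : k * a / 2 - π / 2 * n = π / 2 * (k * a / π - n) := by
  field_simp

lemma fract_pos_lt_one {x : ℝ} (h : ∀ n : ℤ, x ≠ n) : 0 < x - ⌊x⌋ ∧ x - ⌊x⌋ < 1 := by
  have h1 := Int.floor_le x
  have h2 := Int.lt_floor_add_one x
  have h3 : (⌊x⌋ : ℝ) < x := lt_of_le_of_ne h1 (Ne.symm (h _))
  constructor <;> linarith

lemma ne_intCast_of_between {x : ℝ} {n : ℤ} (h₁ : (n : ℝ) < x) (h₂ : x < n + 1) (j : ℤ) :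
    x ≠ j := by
  rintro rfl
  have h₃ : n < j := by exact_mod_cast h₁
  have h₄ : j < n + 1 := by exact_mod_cast h₂
  omega

/-- A set of reals in which any two points with equal labels are joined by a segment has finitely
many components if only finitely many labels occur. -/
lemma finite_gapComponents_of_labels {ι : Type*} (G : Set ℝ) (l : ℝ → ι)
    (hconv : ∀ x ∈ G, ∀ y ∈ G, x ≤ y → l x = l y → Set.Icc x y ⊆ G)
    (hfin : (l '' G).Finite) : (gapComponents G).Finite := by
  classical
  have key : ∀ x ∈ G, ∀ y ∈ G, x ≤ y → l x = l y →
      connectedComponentIn G x = connectedComponentIn G y := fun x hx y hy hxy hl =>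
    connectedComponentIn_eq (isPreconnected_Icc.subset_connectedComponentIn
      (Set.left_mem_Icc.2 hxy) (hconv x hx y hy hxy hl) (Set.right_mem_Icc.2 hxy))
  let f : ι → Set ℝ := fun i =>
    if h : ∃ k ∈ G, l k = i then connectedComponentIn G h.choose else ∅
  refine (hfin.image f).subset ?_
  rintro C ⟨k, hk, rfl⟩
  refine ⟨l k, ⟨k, hk, rfl⟩, ?_⟩
  have h : ∃ k' ∈ G, l k' = l k := ⟨k, hk, rfl⟩
  simp only [f, dif_pos h]
  obtain ⟨h₁, h₂⟩ := h.choose_spec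
  rcases le_total h.choose k with h₃ | h₃
  · exact key _ h₁ _ hk h₃ h₂
  · exact (key _ hk _ h₁ h₃ h₂.symm).symm

lemma finite_of_lt_markovConstant {θ c : ℝ} (hc : 0 < c) (h : c < markovConstant θ) :
    {pq : ℕ × ℕ | pq.2 ≠ 0 ∧
      |θ - (pq.1 : ℝ) / (pq.2 : ℝ)| < c / (pq.2 : ℝ) ^ 2}.Finite := by
  by_contra hinf
  exact notMem_of_lt_csInf h ⟨0, fun x hx => hx.1.le⟩ ⟨hc, hinf⟩

/-- Upper bound for `q * |q θ - p|` when `p, q` are the roundings of `k a / π`, `k b / π`. -/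
lemma mul_abs_sub_le {a b k A p q : ℝ} (ha : 0 < a) (hb : 0 < b) (hk : 0 < k)
    (hq : |q - k * b / π| ≤ 1)
    (hA : π * k * (|p - k * a / π| + |q - k * b / π|) ≤ A) :
    q * |a / b * q - p| ≤ A * max a b / π ^ 2 + (a / b + 1) * A / (π * k) := by
  set s := |p - k * a / π| with hs
  set t := |q - k * b / π| with ht
  have hπ := pi_pos
  have hs0 : 0 ≤ s := abs_nonneg _
  have ht0 : 0 ≤ t := abs_nonneg _
  have hA0 : 0 ≤ A := le_trans (by positivity) hA
  have hθ : 0 < a / b := div_pos ha hb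
  have hx : q ≤ k * b / π + t := by linarith [le_abs_self (q - k * b / π)]
  have hd : |a / b * q - p| ≤ a / b * t + s := by
    have : a / b * q - p = a / b * (q - k * b / π) - (p - k * a / π) := by
      field_simp
      ring
    rw [this]
    refine (abs_sub _ _).trans ?_
    rw [abs_mul, abs_of_pos hθ]
  have hst : s + t ≤ A / (π * k) := by
    rw [le_div_iff₀ (by positivity)]; linarith
  have ht1 : t * (a / b * t + s) ≤ (a / b + 1) * A / (π * k) := by
    have h1 : t * (a / b * t + s) ≤ a / b * t + s := by
      have : 0 ≤ a / b * t + s := by positivity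
      nlinarith
    have h2 : a / b * t + s ≤ (a / b + 1) * (s + t) := by
      have : 0 ≤ a / b * s := by positivity
      nlinarith
    calc _ ≤ (a / b + 1) * (s + t) := h1.trans h2
      _ ≤ (a / b + 1) * (A / (π * k)) := by gcongr
      _ = _ := by ring
  have hmain : k * b / π * (a / b * t + s) ≤ A * max a b / π ^ 2 := by
    have h1 : k * b / π * (a / b * t + s) = k * (a * t + b * s) / π := by
      field_simp
    have h2 : a * t + b * s ≤ max a b * (s + t) := by
      have := mul_le_mul_of_nonneg_right (le_max_left a b) ht0
      have := mul_le_mul_of_nonneg_right (le_max_right a b) hs0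
      linarith
    have hM : 0 < max a b := lt_max_of_lt_left ha
    calc _ = k * (a * t + b * s) / π := h1
      _ ≤ k * (max a b * (s + t)) / π := by gcongr
      _ = max a b * (π * k * (s + t)) / π ^ 2 := by field_simp
      _ ≤ max a b * A / π ^ 2 := by gcongr
      _ = _ := by ring
  calc q * |a / b * q - p| ≤ (k * b / π + t) * (a / b * t + s) := by gcongr
    _ = k * b / π * (a / b * t + s) + t * (a / b * t + s) := by ring
    _ ≤ _ := by linarith

/-- Finiteness of the components of a set on which the sum of the distances of `k a / π` and
`k b / π` to their roundings decays like `A / (π k)`, with `A` below the Markov threshold.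
The rounding is downwards for `e = 0` and upwards for `e = 1`. -/
lemma finite_gapComponents_of_bound {a b A : ℝ} (ha : 0 < a) (hb : 0 < b) (hA : 0 < A)
    (hμ : A < π ^ 2 * markovConstant (a / b) / max a b) {G : Set ℝ} {e : ℤ}
    (he₀ : 0 ≤ e) (he₁ : e ≤ 1) (hpos : ∀ k ∈ G, 0 < k)
    (hconv : ∀ x ∈ G, ∀ y ∈ G, x ≤ y → ⌊x * a / π⌋ = ⌊y * a / π⌋ →
      ⌊x * b / π⌋ = ⌊y * b / π⌋ → Set.Icc x y ⊆ G)
    (hbd : ∀ k ∈ G, π * k * (|((⌊k * a / π⌋ + e : ℤ) : ℝ) - k * a / π|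
      + |((⌊k * b / π⌋ + e : ℤ) : ℝ) - k * b / π|) ≤ A) :
    (gapComponents G).Finite := by
  have hπ := pi_pos
  have hM : 0 < max a b := lt_max_of_lt_left ha
  have hlt : A * max a b / π ^ 2 < markovConstant (a / b) := by
    rw [lt_div_iff₀ hM] at hμ
    rw [div_lt_iff₀ (by positivity)]
    linarith
  obtain ⟨c, hc₁, hc₂⟩ := exists_between hlt
  have hc : 0 < c := lt_trans (by positivity) hc₁
  have hfin := finite_of_lt_markovConstant hc hc₂
  obtain ⟨K, hK⟩ : ∃ K, K = max (π / b) ((a / b + 1) * A / (π * (c - A * max a b / π ^ 2))) :=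
    ⟨_, rfl⟩
  refine finite_gapComponents_of_labels G (fun k => (⌊k * a / π⌋, ⌊k * b / π⌋)) ?_ ?_
  · intro x hx y hy hxy h
    exact hconv x hx y hy hxy (Prod.ext_iff.1 h).1 (Prod.ext_iff.1 h).2
  refine (((Set.finite_Icc (0 : ℤ) ⌊K * a / π⌋).prod (Set.finite_Icc (0 : ℤ) ⌊K * b / π⌋)).union
    (hfin.image fun pq : ℕ × ℕ => ((pq.1 : ℤ) - e, (pq.2 : ℤ) - e))).subset ?_
  rintro _ ⟨k, hk, rfl⟩
  have hk0 := hpos k hk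
  have hm : 0 ≤ ⌊k * a / π⌋ := Int.floor_nonneg.2 (by positivity)
  have hn : 0 ≤ ⌊k * b / π⌋ := Int.floor_nonneg.2 (by positivity)
  rcases le_or_gt k K with hkK | hkK
  · left
    refine ⟨⟨hm, Int.floor_le_floor ?_⟩, ⟨hn, Int.floor_le_floor ?_⟩⟩ <;> gcongr
  right
  have hround : ∀ x : ℝ, |((⌊x⌋ + e : ℤ) : ℝ) - x| ≤ 1 := by
    intro x
    have h₁ := Int.floor_le x
    have h₂ := Int.lt_floor_add_one x
    have h₃ : (0 : ℝ) ≤ e := by exact_mod_cast he₀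
    have h₄ : (e : ℝ) ≤ 1 := by exact_mod_cast he₁
    push_cast
    rw [abs_le]
    constructor <;> linarith
  have hn₁ : 1 ≤ ⌊k * b / π⌋ := by
    have : π / b < k := (le_max_left _ _).trans_lt (hK ▸ hkK)
    rw [div_lt_iff₀ hb] at this
    rw [Int.le_floor, le_div_iff₀ hπ]
    push_cast
    linarith
  obtain ⟨p, hp⟩ := Int.eq_ofNat_of_zero_le (show 0 ≤ ⌊k * a / π⌋ + e by omega)
  obtain ⟨q, hq⟩ := Int.eq_ofNat_of_zero_le (show 0 ≤ ⌊k * b / π⌋ + e by omega)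
  have hq₁ : q ≠ 0 := by omega
  refine ⟨(p, q), ⟨hq₁, ?_⟩, Prod.ext (by simp; omega) (by simp; omega)⟩
  have hbd' := hbd k hk
  have hq' := hround (k * b / π)
  rw [hp] at hbd'
  rw [hq] at hbd' hq'
  simp only [Int.cast_natCast] at hbd' hq'
  have h := mul_abs_sub_le ha hb hk0 hq' hbd'
  have hc' : 0 < c - A * max a b / π ^ 2 := sub_pos.2 hc₁
  have h' : (a / b + 1) * A / (π * k) < c - A * max a b / π ^ 2 := by
    have : (a / b + 1) * A / (π * (c - A * max a b / π ^ 2)) < k :=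
      (le_max_right _ _).trans_lt (hK ▸ hkK)
    rw [div_lt_iff₀ (by positivity)] at this ⊢
    linarith
  have hq0 : (0 : ℝ) < q := by positivity
  have heq : |a / b - (p : ℝ) / q| = q * |a / b * q - p| / (q : ℝ) ^ 2 := by
    have : a / b - (p : ℝ) / q = (a / b * q - p) / q := by field_simp
    rw [this, abs_div, abs_of_pos hq0]
    field_simp
  simp only [heq]
  gcongr
  linarith

lemma floor_eq_of_mem_Icc {x y z : ℝ} (hz : z ∈ Set.Icc x y) (h : ⌊x⌋ = ⌊y⌋) : ⌊z⌋ = ⌊x⌋ :=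
  le_antisymm (h ▸ Int.floor_le_floor hz.2) (Int.floor_le_floor hz.1)

lemma nonint_of_mem_Icc {x y z : ℝ} (hx : ∀ n : ℤ, x ≠ n) (hz : z ∈ Set.Icc x y)
    (h : ⌊x⌋ = ⌊y⌋) (n : ℤ) : z ≠ n := by
  have h₁ := (fract_pos_lt_one hx).1
  have h₂ := Int.lt_floor_add_one z
  rw [floor_eq_of_mem_Icc hz h] at h₂
  exact ne_intCast_of_between (by linarith [hz.1]) h₂ n

lemma mul_div_mem_Icc {x y z a : ℝ} (ha : 0 < a) (hz : z ∈ Set.Icc x y) :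
    z * a / π ∈ Set.Icc (x * a / π) (y * a / π) := by
  have := pi_pos
  obtain ⟨h₁, h₂⟩ := hz
  constructor <;> gcongr

lemma tan_half_nonneg_mono {x z a : ℝ} (ha : 0 < a) (hxz : x ≤ z)
    (h : ⌊x * a / π⌋ = ⌊z * a / π⌋) :
    0 ≤ tan (x * a / 2 - π / 2 * ⌊x * a / π⌋) ∧
      tan (x * a / 2 - π / 2 * ⌊x * a / π⌋) ≤ tan (z * a / 2 - π / 2 * ⌊z * a / π⌋) := by
  have hπ := pi_pos
  have h₁ := Int.floor_le (x * a / π)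
  have h₂ := Int.lt_floor_add_one (z * a / π)
  have h₃ : x * a / π ≤ z * a / π := by gcongr
  rw [half_angle_eq, half_angle_eq]
  rw [← h] at h₂ ⊢
  have h₀ : 0 ≤ π / 2 * (x * a / π - ⌊x * a / π⌋) := by
    have : 0 ≤ x * a / π - ⌊x * a / π⌋ := by linarith
    positivity
  have h₄ : π / 2 * (z * a / π - ⌊x * a / π⌋) < π / 2 := by nlinarith
  have h₅ : π / 2 * (x * a / π - ⌊x * a / π⌋) ≤ π / 2 * (z * a / π - ⌊x * a / π⌋) := by gcongr
  exact ⟨tan_nonneg_of_nonneg_of_le_pi_div_two h₀ (by linarith),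
    strictMonoOn_tan.monotoneOn ⟨by linarith, by linarith⟩ ⟨by linarith, by linarith⟩ h₅⟩

/-- `y ↦ (y + c) cot y` is decreasing on `(0, π / 2)` for `c ≥ 0`. -/
lemma add_mul_cot_antitone {x y c : ℝ} (hx : 0 < x) (hxy : x ≤ y) (hy : y < π / 2)
    (hc : 0 ≤ c) : (y + c) * cot y ≤ (x + c) * cot x := by
  have hπ := pi_pos
  have hsx : 0 < sin x := sin_pos_of_pos_of_lt_pi hx (by linarith)
  have hsy : 0 < sin y := sin_pos_of_pos_of_lt_pi (by linarith) (by linarith)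
  have hd : 0 ≤ sin (y - x) := sin_nonneg_of_nonneg_of_le_pi (by linarith) (by linarith)
  have hconc : (y - x) * sin (y + x) ≤ (y + x) * sin (y - x) := by
    have hs : 0 < y + x := by linarith
    have h := strictConcaveOn_sin_Icc.concaveOn.2
      (⟨hs.le, by linarith⟩ : y + x ∈ Set.Icc 0 π) (⟨le_rfl, hπ.le⟩ : (0 : ℝ) ∈ Set.Icc 0 π)
      (div_nonneg (by linarith) hs.le : 0 ≤ (y - x) / (y + x))
      (by positivity : 0 ≤ 2 * x / (y + x)) (by field_simp; ring)
    simp only [smul_eq_mul, sin_zero, mul_zero, add_zero] at h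
    rw [div_mul_cancel₀ _ hs.ne', div_mul_eq_mul_div, div_le_iff₀ hs] at h
    linarith
  rw [sin_add, sin_sub] at hconc
  rw [sin_sub] at hd
  rw [cot_eq_cos_div_sin, cot_eq_cos_div_sin, mul_div_assoc', mul_div_assoc',
    div_le_div_iff₀ hsy hsx]
  have := mul_nonneg hc hd
  nlinarith

lemma mul_cot_half_antitone {x z a : ℝ} (ha : 0 < a) (hx₀ : 0 < x) (hxz : x ≤ z)
    (hx : ∀ n : ℤ, x * a / π ≠ n) (h : ⌊x * a / π⌋ = ⌊z * a / π⌋) :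
    z * cot (z * a / 2 - π / 2 * ⌊z * a / π⌋) ≤ x * cot (x * a / 2 - π / 2 * ⌊x * a / π⌋) := by
  have hπ := pi_pos
  have h₁ := (fract_pos_lt_one hx).1
  have h₂ := Int.lt_floor_add_one (z * a / π)
  have h₃ : 0 ≤ ⌊x * a / π⌋ := Int.floor_nonneg.2 (by positivity)
  have h₄ : (0 : ℝ) ≤ ⌊x * a / π⌋ := by exact_mod_cast h₃
  have h₅ : x * a / 2 - π / 2 * ⌊x * a / π⌋ ≤ z * a / 2 - π / 2 * ⌊x * a / π⌋ := by gcongr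
  rw [← h] at h₂ ⊢
  have key := add_mul_cot_antitone (c := π / 2 * ⌊x * a / π⌋)
    (by rw [half_angle_eq]; positivity) h₅
    (by rw [half_angle_eq]; nlinarith) (by positivity)
  rw [sub_add_cancel, sub_add_cancel] at key
  refine le_of_mul_le_mul_left ?_ (half_pos ha)
  linarith

lemma cot_eq_tan_pi_div_two_sub (x : ℝ) : cot x = tan (π / 2 - x) := by
  rw [tan_pi_div_two_sub, tan_inv_eq_cot]

lemma le_tan_half {x : ℝ} (h : ∀ n : ℤ, x ≠ n) :
    π / 2 * |((⌊x⌋ + 0 : ℤ) : ℝ) - x| ≤ tan (π / 2 * (x - ⌊x⌋)) := by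
  have hπ := pi_pos
  obtain ⟨h₁, h₂⟩ := fract_pos_lt_one h
  rw [add_zero, abs_sub_comm, abs_of_pos h₁]
  exact le_tan (by positivity) (by nlinarith)

lemma le_cot_half {x : ℝ} (h : ∀ n : ℤ, x ≠ n) :
    π / 2 * |((⌊x⌋ + 1 : ℤ) : ℝ) - x| ≤ cot (π / 2 * (x - ⌊x⌋)) := by
  have hπ := pi_pos
  obtain ⟨h₁, h₂⟩ := fract_pos_lt_one h
  have h₃ : 0 < (⌊x⌋ : ℝ) + 1 - x := by linarith
  push_cast
  rw [abs_of_pos h₃, cot_eq_tan_pi_div_two_sub]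
  have : π / 2 - π / 2 * (x - ⌊x⌋) = π / 2 * (⌊x⌋ + 1 - x) := by ring
  rw [this]
  exact le_tan (by positivity) (by nlinarith)

lemma finite_gapComponents_gapSetPlus {a b α : ℝ} (ha : 0 < a) (hb : 0 < b) (hα : 0 < α)
    (hμ : α < π ^ 2 * markovConstant (a / b) / max a b) :
    (gapComponents (gapSetPlus a b α)).Finite := by
  refine finite_gapComponents_of_bound ha hb hα hμ (e := 0) le_rfl zero_le_one
    (fun k hk => hk.1) ?_ ?_
  · intro x hx y hy hxy hfa hfb z hz
    have hza := mul_div_mem_Icc ha hz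
    have hzb := mul_div_mem_Icc hb hz
    have hz₀ : 0 < z := hx.1.trans_le hz.1
    refine ⟨hz₀, nonint_of_mem_Icc hx.2.1 hza hfa, nonint_of_mem_Icc hx.2.2.1 hzb hfb,
      lt_of_le_of_lt ?_ hy.2.2.2⟩
    obtain ⟨h₁, h₂⟩ := tan_half_nonneg_mono ha hz.2 ((floor_eq_of_mem_Icc hza hfa).trans hfa)
    obtain ⟨h₃, h₄⟩ := tan_half_nonneg_mono hb hz.2 ((floor_eq_of_mem_Icc hzb hfb).trans hfb)
    have := hz.2
    gcongr
    linarith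
  · rintro k ⟨hk, hka, hkb, hlt⟩
    rw [half_angle_eq, half_angle_eq] at hlt
    have h₁ := le_tan_half hka
    have h₂ := le_tan_half hkb
    nlinarith [mul_le_mul_of_nonneg_left (add_le_add h₁ h₂) hk.le]

lemma finite_gapComponents_gapSetMinus {a b α : ℝ} (ha : 0 < a) (hb : 0 < b) (hα : α < 0)
    (hμ : -α < π ^ 2 * markovConstant (a / b) / max a b) :
    (gapComponents (gapSetMinus a b α)).Finite := by
  refine finite_gapComponents_of_bound ha hb (neg_pos.2 hα) hμ (e := 1) zero_le_one le_rfl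
    (fun k hk => hk.1) ?_ ?_
  · intro x hx y hy hxy hfa hfb z hz
    have hza := mul_div_mem_Icc ha hz
    have hzb := mul_div_mem_Icc hb hz
    refine ⟨hx.1.trans_le hz.1, nonint_of_mem_Icc hx.2.1 hza hfa,
      nonint_of_mem_Icc hx.2.2.1 hzb hfb, lt_of_le_of_lt ?_ hx.2.2.2⟩
    have h₁ := mul_cot_half_antitone ha hx.1 hz.1 hx.2.1 (floor_eq_of_mem_Icc hza hfa).symm
    have h₂ := mul_cot_half_antitone hb hx.1 hz.1 hx.2.2.1 (floor_eq_of_mem_Icc hzb hfb).symm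
    linarith
  · rintro k ⟨hk, hka, hkb, hlt⟩
    rw [half_angle_eq, half_angle_eq, abs_of_neg hα] at hlt
    have h₁ := le_cot_half hka
    have h₂ := le_cot_half hkb
    nlinarith [mul_le_mul_of_nonneg_left (add_le_add h₁ h₂) hk.le]

lemma gapSetPlus_comm (a b α : ℝ) : gapSetPlus a b α = gapSetPlus b a α := by
  ext k
  simp only [gapSetPlus, Set.mem_ofPred_eq, add_comm, and_left_comm]

lemma gapSetMinus_comm (a b α : ℝ) : gapSetMinus a b α = gapSetMinus b a α := by
  ext k
  simp only [gapSetMinus, Set.mem_ofPred_eq, add_comm, and_left_comm]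

lemma natCast_mul_nonint {θ : ℝ} (hθ : Irrational θ) {m : ℕ} (hm : 1 ≤ m) (n : ℤ) :
    (m : ℝ) * θ ≠ n :=
  (hθ.natCast_mul (by omega)).ne_int n

lemma gapSetPlus_nonempty_of_lt {a b α : ℝ} (ha : 0 < a) (hθ : Irrational (b / a))
    {m : ℕ} (hm : 1 ≤ m)
    (h : 2 * m * π / a * tan (π / 2 * (m * (b / a) - ⌊m * (b / a)⌋)) < α) :
    (gapSetPlus a b α).Nonempty := by
  have hπ := pi_pos
  have hm₀ : (0 : ℝ) < m := by exact_mod_cast hm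
  obtain ⟨hn₁, hn₂⟩ := fract_pos_lt_one (natCast_mul_nonint hθ hm)
  set n : ℤ := ⌊m * (b / a)⌋ with hn
  set k₀ : ℝ := m * π / a with hk₀
  have hka : k₀ * a / π = m := by rw [hk₀]; field_simp
  have hkb : k₀ * b / π = m * (b / a) := by rw [hk₀]; field_simp
  have hea : k₀ * a / 2 - π / 2 * (m : ℤ) = 0 := by
    rw [half_angle_eq, hka]; simp
  have heb : k₀ * b / 2 - π / 2 * n = π / 2 * (m * (b / a) - n) := by
    rw [half_angle_eq, hkb]
  have hcos : cos (k₀ * b / 2 - π / 2 * n) ≠ 0 := by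
    rw [heb]
    exact (cos_pos_of_mem_Ioo ⟨by nlinarith, by nlinarith⟩).ne'
  have hcont : ContinuousAt (fun k : ℝ => 2 * k * (tan (k * a / 2 - π / 2 * (m : ℤ))
      + tan (k * b / 2 - π / 2 * n))) k₀ := by
    refine ContinuousAt.mul (by fun_prop) (ContinuousAt.add ?_ ?_)
    · exact ContinuousAt.comp (g := tan) (continuousAt_tan.2 (by rw [hea]; simp)) (by fun_prop)
    · exact ContinuousAt.comp (g := tan) (continuousAt_tan.2 hcos) (by fun_prop)
  have hval : 2 * k₀ * (tan (k₀ * a / 2 - π / 2 * (m : ℤ)) + tan (k₀ * b / 2 - π / 2 * n)) < α := by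
    rw [hea, heb, tan_zero, zero_add, hk₀]
    convert h using 1
    ring
  have hlin : ∀ c : ℝ, ContinuousAt (fun k : ℝ => k * c / π) k₀ := fun c => by fun_prop
  have hev₁ := hcont.eventually_lt_const hval
  have hev₂ : ∀ᶠ k in nhds k₀, k * a / π < m + 1 :=
    (hlin a).eventually_lt_const (by simp only [hka]; linarith)
  have hev₃ : ∀ᶠ k in nhds k₀, k * b / π < n + 1 :=
    (hlin b).eventually_lt_const (by simp only [hkb]; linarith)
  have hev₄ : ∀ᶠ k in nhds k₀, n < k * b / π :=
    (hlin b).eventually_const_lt (by simp only [hkb]; linarith)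
  obtain ⟨k, ⟨h₁, h₂, h₃, h₄⟩, h₅⟩ :=
    (((hev₁.and (hev₂.and (hev₃.and hev₄))).filter_mono
      (nhdsWithin_le_nhds (s := Set.Ioi k₀))).and self_mem_nhdsWithin).exists
  have h₅' : k₀ < k := h₅
  have h₆ : ((m : ℤ) : ℝ) < k * a / π := by
    rw [Int.cast_natCast, ← hka]; gcongr
  have h₂' : k * a / π < ((m : ℤ) : ℝ) + 1 := by simpa using h₂
  refine ⟨k, lt_trans (by positivity) h₅', ne_intCast_of_between h₆ h₂',
    ne_intCast_of_between h₄ h₃, ?_⟩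
  rw [Int.floor_eq_iff.2 ⟨h₆.le, h₂'⟩, Int.floor_eq_iff.2 ⟨h₄.le, h₃⟩]
  exact h₁

lemma gapSetMinus_nonempty_of_lt {a b α : ℝ} (ha : 0 < a) (hθ : Irrational (b / a))
    (hα : α < 0) {m : ℕ} (hm : 1 ≤ m)
    (h : -(2 * m * π / a) * tan (π / 2 * (m * (b / a) - ⌈m * (b / a)⌉)) < -α) :
    (gapSetMinus a b α).Nonempty := by
  have hπ := pi_pos
  have hm₀ : (0 : ℝ) < m := by exact_mod_cast hm
  have hni := natCast_mul_nonint hθ hm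
  obtain ⟨hn₁, hn₂⟩ := fract_pos_lt_one hni
  have hceil : ⌈m * (b / a)⌉ = ⌊m * (b / a)⌋ + 1 := by
    rw [Int.ceil_eq_iff]
    push_cast
    constructor <;> linarith
  rw [hceil] at h
  set n : ℤ := ⌊m * (b / a)⌋ with hn
  set k₀ : ℝ := m * π / a with hk₀
  have hk₀_pos : 0 < k₀ := by positivity
  have hka : k₀ * a / π = m := by rw [hk₀]; field_simp
  have hkb : k₀ * b / π = m * (b / a) := by rw [hk₀]; field_simp
  have hea : π / 2 - (k₀ * a / 2 - π / 2 * ((m : ℤ) - 1 : ℤ)) = 0 := by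
    rw [half_angle_eq, hka]; push_cast; ring
  have heb : π / 2 - (k₀ * b / 2 - π / 2 * n) = -(π / 2 * (m * (b / a) - (n + 1 : ℤ))) := by
    rw [half_angle_eq, hkb]; push_cast; ring
  have hcos : cos (π / 2 - (k₀ * b / 2 - π / 2 * n)) ≠ 0 := by
    rw [heb]
    push_cast
    exact (cos_pos_of_mem_Ioo ⟨by nlinarith, by nlinarith⟩).ne'
  have hcont : ContinuousAt (fun k : ℝ => 2 * k *
      (tan (π / 2 - (k * a / 2 - π / 2 * ((m : ℤ) - 1 : ℤ)))
      + tan (π / 2 - (k * b / 2 - π / 2 * n)))) k₀ := by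
    refine ContinuousAt.mul (by fun_prop) (ContinuousAt.add ?_ ?_)
    · exact ContinuousAt.comp (g := tan) (continuousAt_tan.2 (by rw [hea]; simp)) (by fun_prop)
    · exact ContinuousAt.comp (g := tan) (continuousAt_tan.2 hcos) (by fun_prop)
  have hval : 2 * k₀ * (tan (π / 2 - (k₀ * a / 2 - π / 2 * ((m : ℤ) - 1 : ℤ)))
      + tan (π / 2 - (k₀ * b / 2 - π / 2 * n))) < |α| := by
    rw [hea, heb, tan_zero, zero_add, hk₀, tan_neg, abs_of_neg hα]
    convert h using 1
    ring
  have hlin : ∀ c : ℝ, ContinuousAt (fun k : ℝ => k * c / π) k₀ := fun c => by fun_prop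
  have hev₁ := hcont.eventually_lt_const hval
  have hev₂ : ∀ᶠ k in nhds k₀, (m : ℝ) - 1 < k * a / π :=
    (hlin a).eventually_const_lt (by simp only [hka]; linarith)
  have hev₃ : ∀ᶠ k in nhds k₀, k * b / π < n + 1 :=
    (hlin b).eventually_lt_const (by simp only [hkb]; linarith)
  have hev₄ : ∀ᶠ k in nhds k₀, n < k * b / π :=
    (hlin b).eventually_const_lt (by simp only [hkb]; linarith)
  obtain ⟨k, ⟨h₁, h₂, h₃, h₄, h₀⟩, h₅⟩ :=
    (((hev₁.and (hev₂.and (hev₃.and (hev₄.and (lt_mem_nhds hk₀_pos))))).filter_mono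
      (nhdsWithin_le_nhds (s := Set.Iio k₀))).and self_mem_nhdsWithin).exists
  have h₅' : k < k₀ := h₅
  have h₆ : k * a / π < (((m : ℤ) - 1 : ℤ) : ℝ) + 1 := by
    push_cast
    rw [sub_add_cancel, ← hka]; gcongr
  have h₂' : (((m : ℤ) - 1 : ℤ) : ℝ) < k * a / π := by simpa using h₂
  refine ⟨k, h₀, ne_intCast_of_between h₂' h₆, ne_intCast_of_between h₄ h₃, ?_⟩
  rw [Int.floor_eq_iff.2 ⟨h₂'.le, h₆⟩, Int.floor_eq_iff.2 ⟨h₄.le, h₃⟩,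
    cot_eq_tan_pi_div_two_sub, cot_eq_tan_pi_div_two_sub]
  exact h₁

lemma gapSetPlus_nonempty {a b α : ℝ} (ha : 0 < a) (hb : 0 < b) (hθ : Irrational (a / b))
    (h : gammaPlus a b (a / b) < α) : (gapSetPlus a b α).Nonempty := by
  rcases min_lt_iff.1 h with h | h
  · obtain ⟨_, ⟨m, hm, rfl⟩, hlt⟩ := exists_lt_of_csInf_lt (by exact ⟨_, 1, le_rfl, rfl⟩) h
    have hdiv : (m : ℝ) / (a / b) = m * (b / a) := by field_simp
    rw [hdiv] at hlt
    exact gapSetPlus_nonempty_of_lt ha (inv_div a b ▸ hθ.inv) hm hlt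
  · obtain ⟨_, ⟨m, hm, rfl⟩, hlt⟩ := exists_lt_of_csInf_lt (by exact ⟨_, 1, le_rfl, rfl⟩) h
    rw [gapSetPlus_comm]
    exact gapSetPlus_nonempty_of_lt hb hθ hm hlt

lemma gapSetMinus_nonempty {a b α : ℝ} (ha : 0 < a) (hb : 0 < b) (hθ : Irrational (a / b))
    (hα : α < 0) (h : gammaMinus a b (a / b) < -α) : (gapSetMinus a b α).Nonempty := by
  rcases min_lt_iff.1 h with h | h
  · obtain ⟨_, ⟨m, hm, rfl⟩, hlt⟩ := exists_lt_of_csInf_lt (by exact ⟨_, 1, le_rfl, rfl⟩) h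
    have hdiv : (m : ℝ) / (a / b) = m * (b / a) := by field_simp
    rw [hdiv] at hlt
    exact gapSetMinus_nonempty_of_lt ha (inv_div a b ▸ hθ.inv) hα hm hlt
  · obtain ⟨_, ⟨m, hm, rfl⟩, hlt⟩ := exists_lt_of_csInf_lt (by exact ⟨_, 1, le_rfl, rfl⟩) h
    rw [gapSetMinus_comm]
    exact gapSetMinus_nonempty_of_lt hb hθ hα hm hlt

/-- For a rectangular-lattice quantum graph with irrational edge ratio
`θ = a/b`, if the coupling constant satisfies `γ± < ±α < π²·μ(θ)/max{a,b}`, then there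
is a nonzero and finite number of gaps in the positive spectrum. -/
theorem rectangular_lattice_bethe_sommerfeld
    (a b α : ℝ) (ha : 0 < a) (hb : 0 < b) (hθ : Irrational (a / b)) :
    (0 < α → gammaPlus a b (a / b) < α →
      α < π ^ 2 * markovConstant (a / b) / max a b →
      (gapSetPlus a b α).Nonempty ∧ (gapComponents (gapSetPlus a b α)).Finite) ∧
    (α < 0 → gammaMinus a b (a / b) < -α →
      -α < π ^ 2 * markovConstant (a / b) / max a b →
      (gapSetMinus a b α).Nonempty ∧ (gapComponents (gapSetMinus a b α)).Finite) := by
  exact ⟨fun hα hγ hμ => ⟨gapSetPlus_nonempty ha hb hθ hγ,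
      finite_gapComponents_gapSetPlus ha hb hα hμ⟩,
    fun hα hγ hμ => ⟨gapSetMinus_nonempty ha hb hθ hα hγ,
      finite_gapComponents_gapSetMinus ha hb hα hμ⟩⟩
end

section
/- The Markov constant of the golden mean equals 1/√5: μ((1+√5)/2) = 1/√5. -/
open Real in
/-- Every even-indexed Fibonacci quotient approximates the golden ratio with constant `1 / √5`. -/
theorem abs_goldenRatio_sub_fib_div_lt (n : ℕ) :
    |goldenRatio - (Nat.fib (2 * n + 3) : ℝ) / (Nat.fib (2 * n + 2) : ℝ)|
      < 1 / √5 / (Nat.fib (2 * n + 2) : ℝ) ^ 2 := by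
  have hq : (0 : ℝ) < Nat.fib (2 * n + 2) := by exact_mod_cast Nat.fib_pos.2 (by omega)
  have h1 := fib_succ_sub_goldenRatio_mul_fib (2 * n + 2)
  have h2 := coe_fib_eq (2 * n + 2)
  have heven : Even (2 * n + 2) := ⟨n + 1, by ring⟩
  have hpos : 0 < goldenConj ^ (2 * n + 2) := heven.pow_pos goldenConj_ne_zero
  have hmul : goldenConj ^ (2 * n + 2) * goldenRatio ^ (2 * n + 2) = 1 := by
    rw [← mul_pow, goldenConj_mul_goldenRatio, heven.neg_one_pow]
  have h5 : 0 < √5 := by positivity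
  have hdiff : goldenRatio - (Nat.fib (2 * n + 3) : ℝ) / (Nat.fib (2 * n + 2) : ℝ)
      = -(goldenConj ^ (2 * n + 2) / Nat.fib (2 * n + 2)) := by
    rw [← h1]
    field_simp
    ring
  rw [hdiff, abs_neg, abs_of_pos (by positivity), lt_div_iff₀ (by positivity)]
  calc goldenConj ^ (2 * n + 2) / Nat.fib (2 * n + 2) * (Nat.fib (2 * n + 2) : ℝ) ^ 2
      = goldenConj ^ (2 * n + 2) * Nat.fib (2 * n + 2) := by field_simp
    _ = (1 - (goldenConj ^ (2 * n + 2)) ^ 2) / √5 := by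
      rw [h2, ← hmul]
      ring
    _ < 1 / √5 := by
      gcongr
      nlinarith

open Real in
/-- The norm form of `ℤ[φ]` is bounded below by `1` away from the origin. -/
theorem one_le_abs_sub_goldenRatio_mul_abs_sub_goldenConj (p q : ℤ) (hq : q ≠ 0) :
    1 ≤ |(p : ℝ) - goldenRatio * q| * |(p : ℝ) - goldenConj * q| := by
  have hfactor : ((p : ℝ) - goldenRatio * q) * ((p : ℝ) - goldenConj * q)
      = ((p ^ 2 - p * q - q ^ 2 : ℤ) : ℝ) := by
    push_cast
    linear_combination (-(p : ℝ) * q) * goldenRatio_add_goldenConj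
      + (q : ℝ) ^ 2 * goldenRatio_mul_goldenConj
  have hne {x : ℝ} (hx : Irrational x) : (p : ℝ) - x * q ≠ 0 :=
    sub_ne_zero.2 ((hx.mul_intCast hq).ne_int p).symm
  have h0 : (p ^ 2 - p * q - q ^ 2 : ℤ) ≠ 0 := by
    rw [← Int.cast_ne_zero (α := ℝ), ← hfactor]
    exact mul_ne_zero (hne goldenRatio_irrational) (hne goldenConj_irrational)
  rw [← abs_mul, hfactor]
  exact_mod_cast Int.one_le_abs h0

open Real in
/-- A constant approximating the golden ratio infinitely often is at least `1 / √5`. -/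
theorem one_div_sqrt_five_le_of_infinite {c : ℝ} (hc : 0 < c)
    (hinf : {pq : ℕ × ℕ | pq.2 ≠ 0 ∧
      |goldenRatio - (pq.1 : ℝ) / (pq.2 : ℝ)| < c / (pq.2 : ℝ) ^ 2}.Infinite) :
    1 / √5 ≤ c := by
  by_contra! hlt
  have h5 : 0 < √5 := by positivity
  have hgap : 0 < 1 - √5 * c := by
    rw [lt_div_iff₀ h5] at hlt
    linarith
  set K := c ^ 2 / (1 - √5 * c) with hK
  refine hinf ((Set.finite_Iic (⌊2 * K + c⌋₊, ⌊K⌋₊)).subset ?_)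
  rintro ⟨p, q⟩ ⟨hq0, h⟩
  simp only at hq0 h
  have hq1 : (1 : ℝ) ≤ q := by exact_mod_cast Nat.one_le_iff_ne_zero.2 hq0
  have hq : (0 : ℝ) < q := by linarith
  have hd : |(p : ℝ) - goldenRatio * q| < c / q := by
    have : (p : ℝ) - goldenRatio * q = -((goldenRatio - p / q) * q) := by
      field_simp
      ring
    rw [this, abs_neg, abs_mul, abs_of_pos hq]
    calc _ < c / (q : ℝ) ^ 2 * q := by gcongr
      _ = c / q := by field_simp
  have hconj : |(p : ℝ) - goldenConj * q| ≤ c / q + √5 * q := by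
    have : (p : ℝ) - goldenConj * q = (p - goldenRatio * q) + √5 * q := by
      rw [← goldenRatio_sub_goldenConj]
      ring
    rw [this]
    refine (abs_add_le _ _).trans ?_
    rw [abs_of_pos (show 0 < √5 * q by positivity)]
    gcongr
  have hnorm : 1 ≤ c / q * (c / q + √5 * q) := by
    have := one_le_abs_sub_goldenRatio_mul_abs_sub_goldenConj p q (by exact_mod_cast hq0)
    push_cast at this
    exact this.trans (by gcongr)
  have hqK : (q : ℝ) ≤ K := by
    rw [hK, le_div_iff₀ hgap]
    have hexp : c / q * (c / q + √5 * q) = c ^ 2 / (q : ℝ) ^ 2 + √5 * c := by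
      field_simp
    have hsq : (1 - √5 * c) * (q : ℝ) ^ 2 ≤ c ^ 2 := by
      rw [← le_div_iff₀ (by positivity)]
      linarith
    nlinarith [mul_nonneg hgap.le (mul_nonneg hq.le (sub_nonneg.2 hq1))]
  have hpK : (p : ℝ) ≤ 2 * K + c := by
    have hcq : c / q ≤ c := div_le_self hc.le hq1
    have := (abs_lt.1 hd).2
    nlinarith [goldenRatio_lt_two]
  exact ⟨Nat.le_floor hpK, Nat.le_floor hqK⟩

/-- The Markov constant of the golden mean equals `1/√5`. -/
theorem markovConstant_golden_mean :
    markovConstant ((1 + Real.sqrt 5) / 2) = 1 / Real.sqrt 5 := by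
  refine IsLeast.csInf_eq ⟨⟨by positivity, ?_⟩, fun c hc => ?_⟩
  · refine Set.infinite_of_injective_forall_mem
      (f := fun n : ℕ => (Nat.fib (2 * n + 3), Nat.fib (2 * n + 2))) (fun m n h => ?_) fun n => ?_
    · have := Nat.fib_add_two_strictMono.injective (Prod.ext_iff.1 h).2
      omega
    · exact ⟨(Nat.fib_pos.2 (by omega)).ne', abs_goldenRatio_sub_fib_div_lt n⟩
  · exact one_div_sqrt_five_le_of_infinite hc.1 hc.2
end

section
/- Let N ≥ 3, let U be the N×N cyclic permutation matrix over ℂ, let k > 0 with k ≠ 1, and set η := (1−k)/(1+k). Then the matrix (k+1)I + (k−1)U is invertible, and the on-shell scattering matrix S(k) := ((k−1)I + (k+1)U)·((k+1)I + (k−1)U)^{−1} has entries S_{ij}(k) = (1−η²)/(1−η^N) · [ −η·(1−η^{N−2})/(1−η²) · δ_{ij} + (1−δ_{ij})·η^{((j−i−1) mod N)} ], where δ_{ij} is the Kronecker delta and the indices i, j range over ℤ/Nℤ with (j−i−1) mod N taken in {0,1,…,N−1}. -/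
open Real

/-- The `N×N` cyclic permutation matrix: `U i j = 1` iff `j ≡ i + 1 (mod N)`. -/
def cyclicPerm (N : ℕ) : Matrix (Fin N) (Fin N) ℂ :=
  fun i j => if (j : ℕ) = ((i : ℕ) + 1) % N then 1 else 0

theorem cyclicPerm_mul_apply {N : ℕ} (X : Matrix (Fin N) (Fin N) ℂ) (i j : Fin N) :
    (cyclicPerm N * X) i j = X ⟨((i : ℕ) + 1) % N, Nat.mod_lt _ i.pos⟩ j := by
  rw [Matrix.mul_apply, Finset.sum_eq_single ⟨((i : ℕ) + 1) % N, Nat.mod_lt _ i.pos⟩]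
  · simp [cyclicPerm]
  · intro b _ hb
    have : (b : ℕ) ≠ ((i : ℕ) + 1) % N := fun h => hb (Fin.ext h)
    simp [cyclicPerm, this]
  · simp

/-- The circulant matrix with entries `z ^ ((j - i) mod N)`. -/
def circulantPow (N : ℕ) (z : ℂ) : Matrix (Fin N) (Fin N) ℂ :=
  fun i j => z ^ (((j : ℤ) - (i : ℤ)) % (N : ℤ)).toNat

theorem cyclicPerm_mul_circulantPow_apply {N : ℕ} (z : ℂ) (i j : Fin N) :
    (cyclicPerm N * circulantPow N z) i j =
      z ^ (((j : ℤ) - (i : ℤ) - 1) % (N : ℤ)).toNat := by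
  rw [cyclicPerm_mul_apply, circulantPow]
  congr 2
  push_cast
  rw [Int.sub_emod_emod, sub_sub]

theorem toNat_neg_one_emod {N : ℕ} (hN : 0 < N) : ((-1 : ℤ) % (N : ℤ)).toNat = N - 1 := by
  rw [← Int.add_emod_right, Int.emod_eq_of_lt (by omega) (by omega)]
  omega

theorem toNat_sub_emod_of_ne {N : ℕ} {i j : Fin N} (hij : i ≠ j) :
    (((j : ℤ) - (i : ℤ)) % (N : ℤ)).toNat =
      (((j : ℤ) - (i : ℤ) - 1) % (N : ℤ)).toNat + 1 := by
  have hi := i.isLt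
  have hj := j.isLt
  have hne : (i : ℕ) ≠ j := fun h => hij (Fin.ext h)
  rcases lt_or_gt_of_ne hne with h | h
  · rw [Int.emod_eq_of_lt (by omega) (by omega), Int.emod_eq_of_lt (by omega) (by omega)]
    omega
  · rw [← Int.add_emod_right, ← Int.add_emod_right ((j : ℤ) - i - 1),
      Int.emod_eq_of_lt (by omega) (by omega), Int.emod_eq_of_lt (by omega) (by omega)]
    omega

theorem one_sub_smul_cyclicPerm_mul_circulantPow {N : ℕ} (z : ℂ) :
    (1 - z • cyclicPerm N) * circulantPow N z = (1 - z ^ N) • 1 := by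
  ext i j
  rw [sub_mul, one_mul, smul_mul_assoc, Matrix.sub_apply, Matrix.smul_apply,
    cyclicPerm_mul_circulantPow_apply, circulantPow, Matrix.smul_apply]
  by_cases hij : i = j
  · subst hij
    obtain ⟨n, rfl⟩ : ∃ n, N = n + 1 := ⟨N - 1, by have := i.pos; omega⟩
    rw [sub_self, zero_sub, toNat_neg_one_emod i.pos]
    simp [pow_succ']
  · rw [toNat_sub_emod_of_ne hij]
    simp [Matrix.one_apply_ne hij, pow_succ']

/-- For `N ≥ 3`, `k > 0`, `k ≠ 1` and `η = (1−k)/(1+k)`, the matrix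
`(k+1)I + (k−1)U` is invertible, and the on-shell S-matrix
`S(k) = ((k−1)I + (k+1)U)((k+1)I + (k−1)U)⁻¹` has entries
`S_ij = (1−η²)/(1−η^N)·[−η(1−η^{N−2})/(1−η²)·δ_ij + (1−δ_ij)·η^{(j−i−1) mod N}]`. -/
theorem star_graph_s_matrix_entries
    (N : ℕ) (hN : 3 ≤ N) (k : ℝ) (hk : 0 < k) (hk1 : k ≠ 1) (η : ℝ)
    (hη : η = (1 - k) / (1 + k)) :
    IsUnit (((k : ℂ) + 1) • (1 : Matrix (Fin N) (Fin N) ℂ) + ((k : ℂ) - 1) • cyclicPerm N) ∧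
    ∀ i j : Fin N,
      (((((k : ℂ) - 1) • (1 : Matrix (Fin N) (Fin N) ℂ) + ((k : ℂ) + 1) • cyclicPerm N) *
          (((k : ℂ) + 1) • (1 : Matrix (Fin N) (Fin N) ℂ) + ((k : ℂ) - 1) • cyclicPerm N)⁻¹)
          i j)
        = (((1 - η ^ 2) / (1 - η ^ N) *
            ((if i = j then 1 else 0) * (-η * (1 - η ^ (N - 2)) / (1 - η ^ 2)) +
              (if i = j then 0 else 1) *
                η ^ ((((j : ℤ) - (i : ℤ) - 1) % (N : ℤ)).toNat)) : ℝ) : ℂ) := by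
  have hk' : (k : ℂ) + 1 ≠ 0 := by exact_mod_cast (by positivity : k + 1 ≠ 0)
  have hlt : |η| < 1 := by
    rw [hη, abs_lt, lt_div_iff₀ (by positivity), div_lt_iff₀ (by positivity)]
    constructor <;> linarith
  have hpow : ∀ n : ℕ, n ≠ 0 → 1 - η ^ n ≠ 0 := fun n hn h => by
    have := pow_lt_one₀ (abs_nonneg η) hlt hn
    rw [← abs_pow, ← sub_eq_zero.mp h, abs_one] at this
    exact lt_irrefl _ this
  have hN' : (1 : ℂ) - (η : ℂ) ^ N ≠ 0 := by exact_mod_cast hpow N (by omega)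
  have h2 : (1 : ℂ) - (η : ℂ) ^ 2 ≠ 0 := by exact_mod_cast hpow 2 (by omega)
  have hkη : (k : ℂ) - 1 = -(((k : ℂ) + 1) * η) := by
    have : k - 1 = -((k + 1) * η) := by
      rw [hη]
      field_simp
      ring
    exact_mod_cast this
  set G := circulantPow N (η : ℂ) with hG
  have hA : ((k : ℂ) + 1) • (1 : Matrix (Fin N) (Fin N) ℂ) + ((k : ℂ) - 1) • cyclicPerm N =
      ((k : ℂ) + 1) • (1 - (η : ℂ) • cyclicPerm N) := by
    rw [hkη, neg_smul, smul_sub, smul_smul, sub_eq_add_neg]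
  have hinv : (((k : ℂ) + 1) • (1 : Matrix (Fin N) (Fin N) ℂ) +
      ((k : ℂ) - 1) • cyclicPerm N) *
      ((((k : ℂ) + 1) * (1 - (η : ℂ) ^ N))⁻¹ • G) = 1 := by
    rw [hA, smul_mul_smul_comm, one_sub_smul_cyclicPerm_mul_circulantPow, smul_smul]
    convert one_smul ℂ _
    field_simp
  refine ⟨IsUnit.of_mul_eq_one _ hinv, fun i j => ?_⟩
  rw [Matrix.inv_eq_right_inv hinv, mul_smul_comm, Matrix.smul_apply, Matrix.add_mul,
    smul_mul_assoc, smul_mul_assoc, one_mul, Matrix.add_apply, Matrix.smul_apply, Matrix.smul_apply,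
    cyclicPerm_mul_circulantPow_apply, hG, circulantPow, hkη]
  by_cases hij : i = j
  · subst hij
    obtain ⟨n, rfl⟩ : ∃ n, N = n + 2 := ⟨N - 2, by omega⟩
    rw [sub_self, zero_sub, toNat_neg_one_emod i.pos]
    simp only [Int.zero_emod, Int.toNat_zero, pow_zero, smul_eq_mul, if_true,
      Nat.add_sub_cancel, show n + 2 - 1 = n + 1 by omega]
    push_cast
    field_simp
    ring
  · rw [toNat_sub_emod_of_ne hij]
    simp only [smul_eq_mul, if_neg hij]
    push_cast
    field_simp
    ring
end

section
/- Let N ≥ 3, let U be the N×N cyclic permutation matrix over ℂ, and for k > 0 let S(k) := ((k−1)I + (k+1)U)·((k+1)I + (k−1)U)^{−1}. If N is odd, then S(k) converges entrywise to the identity matrix I as k → ∞. If N is even, then S(k) converges entrywise as k → ∞ to the matrix T with entries T_{ij} = ((N−2)/N)·δ_{ij} + (1−δ_{ij})·(2/N)·(−1)^{((j−i−1) mod N)}, which is not a scalar multiple of the identity. -/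
open Real Filter

/-- The high-energy limit of the on-shell S-matrix for a vertex of even degree `N`:
`T_ij = ((N−2)/N)·δ_ij + (1−δ_ij)·(2/N)·(−1)^{(j−i−1) mod N}`. -/
noncomputable def evenDegreeLimit (N : ℕ) : Matrix (Fin N) (Fin N) ℂ :=
  fun i j =>
    if i = j then (((N : ℝ) - 2) / N : ℝ)
    else ((2 / (N : ℝ)) * (-1 : ℝ) ^ ((((j : ℤ) - (i : ℤ) - 1) % (N : ℤ)).toNat) : ℝ)

/-- The matrix of powers `η ^ ((j - i) mod N)`, the unnormalized inverse of `1 - η U`. -/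
def cyclicPowers (N : ℕ) (η : ℂ) : Matrix (Fin N) (Fin N) ℂ :=
  fun i j => η ^ (if (i : ℕ) ≤ j then (j : ℕ) - i else N + j - i)

/-- The residue of `j - i - 1` modulo `N`, for `i j : Fin N`. -/
def cyclicGap {N : ℕ} (i j : Fin N) : ℕ :=
  if (i : ℕ) < j then (j : ℕ) - i - 1 else N + j - i - 1

lemma toNat_emod_eq_cyclicGap {N : ℕ} (i j : Fin N) :
    (((j : ℤ) - (i : ℤ) - 1) % (N : ℤ)).toNat = cyclicGap i j := by
  have hi := i.2
  have hj := j.2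
  unfold cyclicGap
  split_ifs with h
  · rw [Int.emod_eq_of_lt (by omega) (by omega)]
    omega
  · rw [← Int.add_emod_right, Int.emod_eq_of_lt (by omega) (by omega)]
    omega

lemma cyclicPerm_mul_cyclicPowers_apply {N : ℕ} (η : ℂ) (i j : Fin N) :
    (cyclicPerm N * cyclicPowers N η) i j = η ^ cyclicGap i j := by
  have hi := i.2
  have hj := j.2
  have hlt : ((i : ℕ) + 1) % N < N := Nat.mod_lt _ (by omega)
  rw [Matrix.mul_apply, Finset.sum_eq_single ⟨((i : ℕ) + 1) % N, hlt⟩]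
  · simp only [cyclicPerm, if_true, one_mul, cyclicPowers, cyclicGap]
    congr 1
    rcases Nat.lt_or_ge ((i : ℕ) + 1) N with h | h
    · rw [Nat.mod_eq_of_lt h]
      split_ifs <;> omega
    · have hN : (i : ℕ) + 1 = N := by omega
      rw [hN, Nat.mod_self]
      split_ifs <;> omega
  · intro l _ hl
    have : (l : ℕ) ≠ ((i : ℕ) + 1) % N := fun h => hl (Fin.ext h)
    simp [cyclicPerm, this]
  · simp

lemma cyclicGap_self {N : ℕ} (i : Fin N) : cyclicGap i i = N - 1 := by
  unfold cyclicGap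
  split_ifs <;> omega

lemma cyclicPowers_apply_self {N : ℕ} (η : ℂ) (i : Fin N) : cyclicPowers N η i i = 1 := by
  simp [cyclicPowers]

lemma cyclicPowers_apply_of_ne {N : ℕ} (η : ℂ) {i j : Fin N} (h : i ≠ j) :
    cyclicPowers N η i j = η * η ^ cyclicGap i j := by
  have hi := i.2
  have hj := j.2
  have hne : (i : ℕ) ≠ j := fun h' => h (Fin.ext h')
  rw [← pow_succ']
  simp only [cyclicPowers, cyclicGap]
  congr 1
  split_ifs <;> omega

lemma one_sub_smul_cyclicPerm_mul_cyclicPowers {N : ℕ} (η : ℂ) :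
    (1 - η • cyclicPerm N) * cyclicPowers N η = (1 - η ^ N) • 1 := by
  ext i j
  have hN : N - 1 + 1 = N := by have := i.2; omega
  rw [sub_mul, one_mul, smul_mul_assoc, Matrix.sub_apply, Matrix.smul_apply,
    cyclicPerm_mul_cyclicPowers_apply]
  by_cases h : i = j
  · subst h
    rw [cyclicPowers_apply_self, cyclicGap_self, smul_eq_mul, ← pow_succ', hN]
    simp
  · rw [cyclicPowers_apply_of_ne η h]
    simp [h]

/-- Entries of the S-matrix in terms of `η = (1 - k) / (1 + k)`. -/
lemma sMatrix_apply {N : ℕ} {k η : ℂ} (hk : k + 1 ≠ 0) (hη : (k + 1) * η = 1 - k)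
    (hηN : 1 - η ^ N ≠ 0) (i j : Fin N) :
    (((k - 1) • (1 : Matrix (Fin N) (Fin N) ℂ) + (k + 1) • cyclicPerm N) *
      ((k + 1) • (1 : Matrix (Fin N) (Fin N) ℂ) + (k - 1) • cyclicPerm N)⁻¹) i j =
      (η ^ cyclicGap i j - η * cyclicPowers N η i j) / (1 - η ^ N) := by
  have hk' : k - 1 = (k + 1) * (-η) := by linear_combination hη
  have hinv : ((k + 1) • (1 : Matrix (Fin N) (Fin N) ℂ) + (k - 1) • cyclicPerm N)⁻¹ =
      ((k + 1)⁻¹ * (1 - η ^ N)⁻¹) • cyclicPowers N η := by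
    apply Matrix.inv_eq_right_inv
    have hfac : (k + 1) • (1 : Matrix (Fin N) (Fin N) ℂ) + (k - 1) • cyclicPerm N =
        (k + 1) • (1 - η • cyclicPerm N) := by
      rw [hk']
      module
    rw [hfac, smul_mul_smul_comm, one_sub_smul_cyclicPerm_mul_cyclicPowers, smul_smul]
    convert one_smul ℂ _
    field_simp
  rw [hinv, hk', mul_smul_comm, add_mul, smul_mul_assoc, smul_mul_assoc, one_mul,
    Matrix.smul_apply, Matrix.add_apply, Matrix.smul_apply, Matrix.smul_apply,
    cyclicPerm_mul_cyclicPowers_apply]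
  simp only [smul_eq_mul]
  field_simp
  ring

lemma tendsto_cayley_atTop :
    Tendsto (fun k : ℝ => (1 - (k : ℂ)) / (1 + k)) atTop (nhds (-1)) := by
  have h : Tendsto (fun k : ℝ => 2 / (1 + k) - 1) atTop (nhds (0 - 1)) :=
    (tendsto_const_nhds.div_atTop (tendsto_atTop_add_const_left _ _ tendsto_id)).sub_const 1
  have h' := (Complex.continuous_ofReal.tendsto _).comp h
  simp only [zero_sub, Complex.ofReal_neg, Complex.ofReal_one] at h'
  refine h'.congr' ?_
  filter_upwards [eventually_gt_atTop 0] with k hk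
  have : (1 + (k : ℂ)) ≠ 0 := by
    exact_mod_cast (by positivity : (1 + k) ≠ 0)
  simp only [Function.comp_apply]
  push_cast
  field_simp
  ring

lemma norm_cayley_lt_one {k : ℝ} (hk : 0 < k) : ‖(1 - (k : ℂ)) / (1 + k)‖ < 1 := by
  have : (1 - (k : ℂ)) / (1 + k) = (((1 - k) / (1 + k) : ℝ) : ℂ) := by push_cast; rfl
  rw [this, Complex.norm_real, Real.norm_eq_abs, abs_lt]
  constructor
  · rw [lt_div_iff₀ (by positivity)]
    linarith
  · rw [div_lt_one (by positivity)]
    linarith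

lemma one_sub_pow_ne_zero_of_norm_lt_one {η : ℂ} (h : ‖η‖ < 1) {n : ℕ} (hn : n ≠ 0) :
    1 - η ^ n ≠ 0 := by
  intro h0
  have h1 : ‖η ^ n‖ < 1 := by
    rw [norm_pow]
    exact pow_lt_one₀ (norm_nonneg _) h hn
  rw [← sub_eq_zero.mp h0, norm_one] at h1
  exact lt_irrefl _ h1

/-- The high-energy limit of the S-matrix is the limit `η → -1` inside the unit disc. -/
lemma tendsto_sMatrix_apply {N : ℕ} (i j : Fin N) {f : ℂ → ℂ} (hf : ContinuousAt f (-1))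
    (hfη : ∀ η : ℂ, ‖η‖ < 1 →
      (η ^ cyclicGap i j - η * cyclicPowers N η i j) / (1 - η ^ N) = f η) :
    Tendsto (fun k : ℝ =>
      (((((k : ℂ) - 1) • (1 : Matrix (Fin N) (Fin N) ℂ) + ((k : ℂ) + 1) • cyclicPerm N) *
        (((k : ℂ) + 1) • (1 : Matrix (Fin N) (Fin N) ℂ) +
          ((k : ℂ) - 1) • cyclicPerm N)⁻¹) i j)) atTop (nhds (f (-1))) := by
  refine (hf.tendsto.comp tendsto_cayley_atTop).congr' ?_
  filter_upwards [eventually_gt_atTop 0] with k hk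
  have hk1 : (k : ℂ) + 1 ≠ 0 := by
    exact_mod_cast (by positivity : (k + 1) ≠ 0)
  have hlt := norm_cayley_lt_one hk
  have hN : N ≠ 0 := by have := i.2; omega
  rw [sMatrix_apply hk1 _ (one_sub_pow_ne_zero_of_norm_lt_one hlt hN), hfη _ hlt]
  · rfl
  · rw [add_comm (1 : ℂ) k, mul_div_cancel₀ _ hk1]

lemma sMatrix_formula_of_ne {N : ℕ} {i j : Fin N} (h : i ≠ j) (η : ℂ) :
    (η ^ cyclicGap i j - η * cyclicPowers N η i j) / (1 - η ^ N) =
      η ^ cyclicGap i j * (1 - η ^ 2) / (1 - η ^ N) := by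
  rw [cyclicPowers_apply_of_ne η h]
  ring

lemma one_sub_pow_two_mul (η : ℂ) (m : ℕ) :
    1 - η ^ (2 * m) = (1 - η ^ 2) * ∑ l ∈ Finset.range m, (η ^ 2) ^ l := by
  rw [mul_neg_geom_sum, pow_mul]

lemma tendsto_sMatrix_odd {N : ℕ} (hN : Odd N) (i j : Fin N) :
    Tendsto (fun k : ℝ =>
      (((((k : ℂ) - 1) • (1 : Matrix (Fin N) (Fin N) ℂ) + ((k : ℂ) + 1) • cyclicPerm N) *
        (((k : ℂ) + 1) • (1 : Matrix (Fin N) (Fin N) ℂ) +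
          ((k : ℂ) - 1) • cyclicPerm N)⁻¹) i j))
      atTop (nhds ((1 : Matrix (Fin N) (Fin N) ℂ) i j)) := by
  have hden : (1 : ℂ) - (-1) ^ N ≠ 0 := by
    rw [hN.neg_one_pow]
    norm_num
  by_cases h : i = j
  · subst h
    have hev : Even (N - 1) := Nat.Odd.sub_odd hN odd_one
    convert tendsto_sMatrix_apply i i
      (f := fun η => (η ^ (N - 1) - η) / (1 - η ^ N)) ?_ ?_ using 2
    · rw [hN.neg_one_pow, hev.neg_one_pow]
      norm_num
    · exact ContinuousAt.div (by fun_prop) (by fun_prop) hden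
    · intro η _
      rw [cyclicGap_self, cyclicPowers_apply_self, mul_one]
  · convert tendsto_sMatrix_apply i j
      (f := fun η => η ^ cyclicGap i j * (1 - η ^ 2) / (1 - η ^ N)) ?_ ?_ using 2
    · simp [h]
    · exact ContinuousAt.div (by fun_prop) (by fun_prop) hden
    · exact fun η _ => sMatrix_formula_of_ne h η

lemma tendsto_sMatrix_even {N : ℕ} (hN : Even N) (i j : Fin N) :
    Tendsto (fun k : ℝ =>
      (((((k : ℂ) - 1) • (1 : Matrix (Fin N) (Fin N) ℂ) + ((k : ℂ) + 1) • cyclicPerm N) *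
        (((k : ℂ) + 1) • (1 : Matrix (Fin N) (Fin N) ℂ) +
          ((k : ℂ) - 1) • cyclicPerm N)⁻¹) i j))
      atTop (nhds (evenDegreeLimit N i j)) := by
  obtain ⟨m, rfl⟩ := hN.exists_two_nsmul
  simp only [smul_eq_mul] at i j ⊢
  have hm : m ≠ 0 := by have := i.2; omega
  have hmC : (m : ℂ) ≠ 0 := by exact_mod_cast hm
  have hden : ∑ l ∈ Finset.range m, (((-1 : ℂ)) ^ 2) ^ l ≠ 0 := by simpa using hm
  by_cases h : i = j
  · subst h
    convert tendsto_sMatrix_apply i i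
      (f := fun η => -η * (∑ l ∈ Finset.range (m - 1), (η ^ 2) ^ l) /
        ∑ l ∈ Finset.range m, (η ^ 2) ^ l) ?_ ?_ using 2
    · have hm1 : ((m - 1 : ℕ) : ℂ) = m - 1 := by
        rw [Nat.cast_sub (Nat.one_le_iff_ne_zero.mpr hm), Nat.cast_one]
      simp [evenDegreeLimit, hm1]
      field_simp
    · exact ContinuousAt.div (by fun_prop) (by fun_prop) hden
    · intro η hη
      have h2 := one_sub_pow_ne_zero_of_norm_lt_one hη two_ne_zero
      have hexp : 2 * m - 1 = 2 * (m - 1) + 1 := by omega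
      have hnum : η ^ (2 * m - 1) - η = (1 - η ^ 2) *
          (-η * ∑ l ∈ Finset.range (m - 1), (η ^ 2) ^ l) := by
        rw [hexp, pow_succ]
        linear_combination -η * one_sub_pow_two_mul η (m - 1)
      rw [cyclicGap_self, cyclicPowers_apply_self, mul_one, hnum, one_sub_pow_two_mul,
        mul_div_mul_left _ _ h2]
  · convert tendsto_sMatrix_apply i j
      (f := fun η => η ^ cyclicGap i j / ∑ l ∈ Finset.range m, (η ^ 2) ^ l) ?_ ?_ using 2
    · simp only [evenDegreeLimit, h, if_false, toNat_emod_eq_cyclicGap]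
      push_cast
      simp
      field_simp
    · exact ContinuousAt.div (by fun_prop) (by fun_prop) hden
    · intro η hη
      have h2 := one_sub_pow_ne_zero_of_norm_lt_one hη two_ne_zero
      rw [sMatrix_formula_of_ne h, one_sub_pow_two_mul, mul_comm (η ^ _),
        mul_div_mul_left _ _ h2]

lemma evenDegreeLimit_ne_smul_one {N : ℕ} (hN : 2 ≤ N) (c : ℂ) :
    evenDegreeLimit N ≠ c • (1 : Matrix (Fin N) (Fin N) ℂ) := by
  intro h
  have hne : (⟨0, by omega⟩ : Fin N) ≠ ⟨1, by omega⟩ := by simp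
  have h01 := congrFun (congrFun h ⟨0, by omega⟩) ⟨1, by omega⟩
  have hN0 : N ≠ 0 := by omega
  rw [Matrix.smul_apply, Matrix.one_apply_ne hne] at h01
  simp [evenDegreeLimit, hN0] at h01

/-- As `k → ∞`, the on-shell S-matrix
`S(k) = ((k−1)I + (k+1)U)((k+1)I + (k−1)U)⁻¹` of a degree-`N` star graph converges
entrywise to the identity when `N` is odd, and, when `N` is even, to the matrix
`T_ij = ((N−2)/N)·δ_ij + (1−δ_ij)·(2/N)·(−1)^{(j−i−1) mod N}`, which is not a scalar
multiple of the identity. -/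
theorem star_graph_s_matrix_high_energy_parity (N : ℕ) (hN : 3 ≤ N) :
    (Odd N → ∀ i j : Fin N,
      Tendsto (fun k : ℝ =>
          (((((k : ℂ) - 1) • (1 : Matrix (Fin N) (Fin N) ℂ) + ((k : ℂ) + 1) • cyclicPerm N) *
            (((k : ℂ) + 1) • (1 : Matrix (Fin N) (Fin N) ℂ) +
              ((k : ℂ) - 1) • cyclicPerm N)⁻¹) i j))
        atTop (nhds ((1 : Matrix (Fin N) (Fin N) ℂ) i j))) ∧
    (Even N →
      (∀ i j : Fin N,
        Tendsto (fun k : ℝ =>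
            (((((k : ℂ) - 1) • (1 : Matrix (Fin N) (Fin N) ℂ) + ((k : ℂ) + 1) • cyclicPerm N) *
              (((k : ℂ) + 1) • (1 : Matrix (Fin N) (Fin N) ℂ) +
                ((k : ℂ) - 1) • cyclicPerm N)⁻¹) i j))
          atTop (nhds (evenDegreeLimit N i j))) ∧
      ¬∃ c : ℂ, evenDegreeLimit N = c • (1 : Matrix (Fin N) (Fin N) ℂ)) := by
  exact ⟨fun h => tendsto_sMatrix_odd h, fun h => ⟨tendsto_sMatrix_even h,
    fun ⟨c, hc⟩ => evenDegreeLimit_ne_smul_one (by omega) c hc⟩⟩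
end

section
/- Let N ≥ 3, let U be the N×N cyclic permutation matrix over ℂ, and let κ > 0. Then the matrix (1−iκ)U − (1+iκ)I is singular (i.e., has nontrivial kernel) if and only if κ = tan(πm/N) for some integer m with 1 ≤ m ≤ ⌈N/2⌉ − 1. In particular, for every N ≥ 3 there exists at least one such κ > 0. -/
open Real

theorem smul_cyclicPerm_sub_mulVec_apply {N : ℕ} (hN : 0 < N) (a b : ℂ) (v : Fin N → ℂ)
    (i : Fin N) :
    Matrix.mulVec (a • cyclicPerm N - b • (1 : Matrix (Fin N) (Fin N) ℂ)) v i =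
      a * v ⟨((i : ℕ) + 1) % N, Nat.mod_lt _ hN⟩ - b * v i := by
  have h : Matrix.mulVec (cyclicPerm N) v i = v ⟨((i : ℕ) + 1) % N, Nat.mod_lt _ hN⟩ := by
    rw [Matrix.mulVec, dotProduct, Finset.sum_eq_single ⟨((i : ℕ) + 1) % N, Nat.mod_lt _ hN⟩]
    · simp [cyclicPerm]
    · intro j _ hj
      have : (j : ℕ) ≠ ((i : ℕ) + 1) % N := fun e => hj (Fin.ext e)
      simp [cyclicPerm, this]
    · simp
  rw [Matrix.sub_mulVec, Matrix.smul_mulVec, Matrix.smul_mulVec, Matrix.one_mulVec,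
    Pi.sub_apply, Pi.smul_apply, Pi.smul_apply, h, smul_eq_mul, smul_eq_mul]

/-- The eigenvalues of the cyclic permutation matrix are the `N`-th roots of unity. -/
theorem exists_smul_cyclicPerm_sub_mulVec_eq_zero_iff {N : ℕ} (hN : 0 < N) {a b r : ℂ}
    (ha : a ≠ 0) (hb : b = a * r) :
    (∃ v : Fin N → ℂ, v ≠ 0 ∧
      Matrix.mulVec (a • cyclicPerm N - b • (1 : Matrix (Fin N) (Fin N) ℂ)) v = 0) ↔
      r ^ N = 1 := by
  subst hb
  constructor
  · rintro ⟨v, hv, h⟩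
    have step (i : Fin N) : v ⟨((i : ℕ) + 1) % N, Nat.mod_lt _ hN⟩ = r * v i := by
      have hi := congrFun h i
      rw [smul_cyclicPerm_sub_mulVec_apply hN, Pi.zero_apply, mul_assoc, ← mul_sub] at hi
      exact sub_eq_zero.mp ((mul_eq_zero.mp hi).resolve_left ha)
    have key (n : ℕ) : v ⟨n % N, Nat.mod_lt _ hN⟩ = r ^ n * v ⟨0, hN⟩ := by
      induction n with
      | zero => simp
      | succ n ih =>
        have := step ⟨n % N, Nat.mod_lt _ hN⟩
        simp only [Nat.mod_add_mod] at this
        rw [this, ih, pow_succ']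
        ring
    have h0 : v ⟨0, hN⟩ ≠ 0 := by
      intro h0
      apply hv
      funext i
      have := key i
      simpa [h0, Nat.mod_eq_of_lt i.isLt] using this
    have hk := key N
    simp only [Nat.mod_self] at hk
    exact mul_right_cancel₀ h0 (by rw [one_mul, ← hk])
  · intro hr
    refine ⟨fun i => r ^ (i : ℕ), fun h => ?_, ?_⟩
    · simpa using congrFun h ⟨0, hN⟩
    · funext i
      rw [smul_cyclicPerm_sub_mulVec_apply hN, Pi.zero_apply, ← pow_eq_pow_mod _ hr, pow_succ]
      ring

theorem one_sub_I_mul_ofReal_ne_zero (x : ℝ) : 1 - Complex.I * (x : ℂ) ≠ 0 := by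
  intro h
  simpa using congrArg Complex.re h

theorem one_add_I_mul_tan {θ : ℝ} (hθ : Real.cos θ ≠ 0) :
    1 + Complex.I * (Real.tan θ : ℂ) =
      (1 - Complex.I * (Real.tan θ : ℂ)) * Complex.exp (2 * θ * Complex.I) := by
  have hc : Complex.cos θ ≠ 0 := by exact_mod_cast hθ
  have hexp : Complex.exp (2 * θ * Complex.I) =
      (Complex.cos θ + Complex.sin θ * Complex.I) ^ 2 := by
    rw [← Complex.exp_mul_I, ← Complex.exp_nat_mul]
    push_cast
    ring_nf
  rw [hexp, Complex.ofReal_tan, Complex.tan_eq_sin_div_cos]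
  field_simp
  linear_combination (-(Complex.cos θ + Complex.I * Complex.sin θ)) *
      (Complex.sin_sq_add_cos_sq (θ : ℂ)) +
    Complex.sin θ ^ 2 * (Complex.cos θ + Complex.I * Complex.sin θ) * Complex.I_sq

theorem exp_two_mul_I_pow_eq_one_iff {N : ℕ} (hN : 0 < N) (θ : ℝ) :
    Complex.exp (2 * θ * Complex.I) ^ N = 1 ↔ ∃ n : ℤ, θ = π * n / N := by
  have hN' : (N : ℝ) ≠ 0 := by positivity
  rw [← Complex.exp_nat_mul, Complex.exp_eq_one_iff]
  refine exists_congr fun n => ?_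
  rw [eq_div_iff hN', ← Complex.ofReal_inj]
  push_cast
  constructor
  · intro h
    apply mul_left_cancel₀ (mul_ne_zero two_ne_zero Complex.I_ne_zero)
    linear_combination h
  · intro h
    linear_combination 2 * Complex.I * h

theorem pi_mul_div_mem_Ioo_iff {N : ℕ} (hN : 0 < N) (n : ℤ) :
    π * n / N ∈ Set.Ioo 0 (π / 2) ↔ 0 < n ∧ 2 * n < N := by
  have hN' : (0 : ℝ) < N := by positivity
  rw [Set.mem_Ioo, div_pos_iff_of_pos_right hN', mul_pos_iff_of_pos_left pi_pos, Int.cast_pos,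
    div_lt_div_iff₀ hN' two_pos, mul_assoc, mul_lt_mul_iff_right₀ pi_pos]
  refine and_congr_right fun _ => ?_
  rw [mul_comm]
  exact_mod_cast Iff.rfl

theorem exists_mulVec_eq_zero_iff_exists_eq_tan {N : ℕ} (hN : 0 < N) {κ : ℝ} (hκ : 0 < κ) :
    (∃ v : Fin N → ℂ, v ≠ 0 ∧
      Matrix.mulVec
        ((1 - Complex.I * (κ : ℂ)) • cyclicPerm N -
          (1 + Complex.I * (κ : ℂ)) • (1 : Matrix (Fin N) (Fin N) ℂ)) v = 0) ↔
      ∃ m : ℕ, 1 ≤ m ∧ m ≤ (N + 1) / 2 - 1 ∧ κ = Real.tan (π * m / N) := by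
  have hmul := one_add_I_mul_tan (Real.cos_arctan_pos κ).ne'
  rw [Real.tan_arctan] at hmul
  rw [exists_smul_cyclicPerm_sub_mulVec_eq_zero_iff hN (one_sub_I_mul_ofReal_ne_zero κ) hmul,
    exp_two_mul_I_pow_eq_one_iff hN]
  constructor
  · rintro ⟨n, hn⟩
    have hmem : π * n / N ∈ Set.Ioo 0 (π / 2) :=
      hn ▸ ⟨Real.arctan_pos.mpr hκ, Real.arctan_lt_pi_div_two κ⟩
    obtain ⟨hpos, hlt⟩ := (pi_mul_div_mem_Ioo_iff hN n).mp hmem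
    lift n to ℕ using hpos.le
    refine ⟨n, by omega, by omega, ?_⟩
    rw [← Real.tan_arctan κ, hn, Int.cast_natCast]
  · rintro ⟨m, h1, h2, rfl⟩
    have hmem := (pi_mul_div_mem_Ioo_iff hN m).mpr ⟨by omega, by omega⟩
    rw [Int.cast_natCast] at hmem
    exact ⟨m, by rw [Int.cast_natCast,
      Real.arctan_tan (by linarith [hmem.1, pi_pos]) hmem.2]⟩

/-- For `N ≥ 3` and `κ > 0`, the matrix `(1−iκ)U − (1+iκ)I` has a
nontrivial kernel if and only if `κ = tan(πm/N)` for some integer `1 ≤ m ≤ ⌈N/2⌉ − 1`;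
in particular, for every `N ≥ 3` at least one such `κ > 0` exists. -/
theorem star_graph_negative_eigenvalues (N : ℕ) (hN : 3 ≤ N) :
    (∀ κ : ℝ, 0 < κ →
      ((∃ v : Fin N → ℂ, v ≠ 0 ∧
          Matrix.mulVec
            ((1 - Complex.I * (κ : ℂ)) • cyclicPerm N -
              (1 + Complex.I * (κ : ℂ)) • (1 : Matrix (Fin N) (Fin N) ℂ)) v = 0) ↔
        (∃ m : ℕ, 1 ≤ m ∧ m ≤ (N + 1) / 2 - 1 ∧ κ = Real.tan (π * m / N)))) ∧
    (∃ κ : ℝ, 0 < κ ∧ ∃ v : Fin N → ℂ, v ≠ 0 ∧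
      Matrix.mulVec
        ((1 - Complex.I * (κ : ℂ)) • cyclicPerm N -
          (1 + Complex.I * (κ : ℂ)) • (1 : Matrix (Fin N) (Fin N) ℂ)) v = 0) := by
  have hN0 : 0 < N := by omega
  refine ⟨fun κ hκ => exists_mulVec_eq_zero_iff_exists_eq_tan hN0 hκ, ?_⟩
  have hmem := (pi_mul_div_mem_Ioo_iff hN0 1).mpr ⟨by omega, by omega⟩
  have hκ : 0 < Real.tan (π * (1 : ℕ) / N) :=
    Real.tan_pos_of_pos_of_lt_pi_div_two (by simpa using hmem.1) (by simpa using hmem.2)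
  exact ⟨_, hκ,
    (exists_mulVec_eq_zero_iff_exists_eq_tan hN0 hκ).mpr ⟨1, le_rfl, by omega, rfl⟩⟩
end
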